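/- For even k, the coefficient identity ((πi)^k/k!) ∑_{m=0}^{k} (2^{m−1} − 1) B_m E_{k−m} C(k,m) z^{m−1} = −2^k ∑_{n=1}^∞ χ₋₄(n) csc(πnz/2)/n^k + z^{k−1} ψ_k(1 + 1/z) holds for appropriate algebraic irrational z. -/

import Mathlib

open Real Complex

/-- The nontrivial Dirichlet character modulo 4, as a real-valued function. -/
def chiFour (n : ℕ) : ℝ := if n % 4 = 1 then 1 else if n % 4 = 3 then -1 else 0

/-- The Euler numbers `E_m`: `E_0 = 1`, `E_m = 0` for odd `m`, and
`∑_{k=0}^{n} C(2n, 2k) E_{2k} = 0` for `n ≥ 1`; they are the Taylor coefficients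
of the secant: `sec(πx) = ∑ E_m (πix)^m / m!`. -/
def eulerNumber : ℕ → ℚ
  | 0 => 1
  | (n + 1) =>
    if (n + 1) % 2 = 1 then 0
    else -∑ k ∈ (Finset.range ((n + 1) / 2)).attach,
      ((n + 1).choose (2 * k.1) : ℚ) * eulerNumber (2 * k.1)
  decreasing_by
    have := k.2
    simp only [Finset.mem_range] at this
    omega


lemma szc_residue_sum {ι : Type} [DecidableEq ι] (a r : ι → ℂ) (R : ℝ) (hR : 0 < R) (s : Finset ι) :
    ∀ f : ℂ → ℂ, (∀ i ∈ s, a i ∈ Metric.ball (0:ℂ) R) → Set.InjOn a (s : Set ι) →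
    (∀ w ∈ Metric.closedBall (0:ℂ) R, (∀ i ∈ s, w ≠ a i) → DifferentiableAt ℂ f w) →
    (∀ i ∈ s, Filter.Tendsto (fun w => (w - a i) * f w) (nhdsWithin (a i) {a i}ᶜ) (nhds (r i))) →
    (∮ w in C(0, R), f w) = 2 * π * I * ∑ i ∈ s, r i := by
  induction s using Finset.induction_on with
  | empty =>
    intro f _ _ hd _
    simp only [Finset.sum_empty, mul_zero]
    apply circleIntegral_eq_zero_of_differentiable_on_off_countable hR.le Set.countable_empty
    · intro w hw
      exact (hd w hw (by simp)).continuousAt.continuousWithinAt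
    · intro w hw
      exact hd w (Metric.ball_subset_closedBall hw.1) (by simp)
  | insert i s his ih =>
    intro f hball hinj hd hlim
    have hai := hball i (Finset.mem_insert_self i s)
    have hne : ∀ j ∈ s, a j ≠ a i := by
      intro j hj h
      have := hinj (by simp [hj]) (by simp) h
      exact his (this ▸ hj)
    set g : ℂ → ℂ := Function.update (fun w => (w - a i) * f w) (a i) (r i) with hg
    have hev : ∀ w, w ≠ a i → g =ᶠ[nhds w] (fun w => (w - a i) * f w) := by
      intro w hw
      filter_upwards [isOpen_ne.mem_nhds hw] with v hv
      exact Function.update_of_ne hv _ _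
    have hgd : ∀ w ∈ Metric.closedBall (0:ℂ) R, w ≠ a i → (∀ j ∈ s, w ≠ a j) →
        DifferentiableAt ℂ g w := by
      intro w hw hwi hws
      rw [(hev w hwi).differentiableAt_iff]
      have := hd w hw (by
        intro j hj
        rcases Finset.mem_insert.1 hj with rfl | hj
        · exact hwi
        · exact hws j hj)
      fun_prop
    have hga : AnalyticAt ℂ g (a i) := by
      apply analyticAt_of_differentiable_on_punctured_nhds_of_continuousAt
      · have h1 : ∀ᶠ w in nhdsWithin (a i) {a i}ᶜ, w ∈ Metric.ball (0:ℂ) R :=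
          (Metric.isOpen_ball.mem_nhds hai) |> fun h => nhdsWithin_le_nhds h
        have h2 : ∀ᶠ w in nhdsWithin (a i) {a i}ᶜ, ∀ j ∈ s, w ≠ a j := by
          rw [Filter.eventually_all_finset]
          intro j hj
          exact nhdsWithin_le_nhds (isOpen_ne.mem_nhds (hne j hj).symm)
        filter_upwards [h1, h2, self_mem_nhdsWithin] with w h1 h2 h3
        exact hgd w (Metric.ball_subset_closedBall h1) h3 h2
      · rw [hg, continuousAt_update_same]
        exact hlim i (Finset.mem_insert_self i s)
    have hgi : g (a i) = r i := by simp [hg]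
    set h : ℂ → ℂ := dslope g (a i) with hh
    have hfh : ∀ w, w ≠ a i → h w = f w - r i * (w - a i)⁻¹ := by
      intro w hw
      rw [hh, dslope_of_ne _ hw, slope_def_field, hgi, hg, Function.update_of_ne hw]
      have := sub_ne_zero.2 hw
      field_simp
    have hhd : ∀ w ∈ Metric.closedBall (0:ℂ) R, (∀ j ∈ s, w ≠ a j) → DifferentiableAt ℂ h w := by
      intro w hw hws
      by_cases hwi : w = a i
      · rw [hwi]
        obtain ⟨p, hp⟩ := hga
        exact (hp.has_fpower_series_dslope_fslope).analyticAt.differentiableAt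
      · rw [hh, differentiableAt_dslope_of_ne hwi]
        exact hgd w hw hwi hws
    have key := ih h (fun j hj => hball j (Finset.mem_insert_of_mem hj))
      (hinj.mono (by simp)) hhd (by
        intro j hj
        have h1 := hlim j (Finset.mem_insert_of_mem hj)
        have h2 : Filter.Tendsto (fun w => (w - a j) * (r i * (w - a i)⁻¹))
            (nhdsWithin (a j) {a j}ᶜ) (nhds 0) := by
          have : ContinuousAt (fun w => (w - a j) * (r i * (w - a i)⁻¹)) (a j) := by
            have := sub_ne_zero.2 (hne j hj)
            fun_prop (disch := assumption)
          have h3 := this.tendsto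
          simp only [sub_self, zero_mul] at h3
          exact h3.mono_left nhdsWithin_le_nhds
        have h3 := h1.sub h2
        rw [sub_zero] at h3
        refine h3.congr' ?_
        filter_upwards [nhdsWithin_le_nhds (isOpen_ne.mem_nhds (hne j hj))] with w hw
        rw [hfh w hw]; ring)
    have hsph : ∀ w ∈ Metric.sphere (0:ℂ) R, ∀ j ∈ insert i s, w ≠ a j := by
      intro w hw j hj hwj
      have := hball j hj
      rw [← hwj] at this
      simp at this hw
      linarith
    have hint : ∮ w in C(0,R), f w = ∮ w in C(0,R), (h w + r i * (w - a i)⁻¹) := by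
      apply circleIntegral.integral_congr hR.le
      intro w hw
      simp only
      rw [hfh w (hsph w hw i (by simp))]; ring
    rw [hint, circleIntegral.integral_add, key, circleIntegral.integral_const_mul,
      circleIntegral.integral_sub_inv_of_mem_ball hai, Finset.sum_insert his]
    · ring
    · apply ContinuousOn.circleIntegrable hR.le
      intro w hw
      exact (hhd w (Metric.sphere_subset_closedBall hw)
        (fun j hj => hsph w hw j (by simp [hj]))).continuousAt.continuousWithinAt
    · apply ContinuousOn.circleIntegrable hR.le
      intro w hw
      have := sub_ne_zero.2 (hsph w hw i (by simp))
      apply ContinuousAt.continuousWithinAt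
      fun_prop (disch := assumption)

/-- lower bound for the sine away from integers -/
lemma szc_sin_lower (δ : ℝ) (hδ : 0 < δ) (u : ℂ) (hu : ∀ n : ℤ, δ ≤ ‖u - n‖) :
    δ / 2 ≤ ‖Complex.sin (π * u)‖ := by
  set n := round u.re
  have h1 : |u.re - n| ≤ 1 / 2 := abs_sub_round _
  have h3 : ‖Complex.sin (π * u)‖ = ‖Complex.sin (π * (u - n))‖ := by
    have : (π * u : ℂ) = π * (u - n) + n * π := by ring
    rw [this, Complex.sin_antiperiodic.add_int_mul_eq, norm_mul]
    rcases Int.even_or_odd n with h | h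
    · simp [Int.negOnePow_even n h]
    · simp [Int.negOnePow_odd n h]
  rw [h3]
  have h4 := hu n
  set v := u - n
  have hvre : v.re = u.re - n := by simp [v]
  rw [← hvre] at h1
  have h5 : ‖Complex.sin (π * v)‖ ^ 2 = Real.sin (π * v.re) ^ 2 + Real.sinh (π * v.im) ^ 2 := by
    rw [Complex.sq_norm, Complex.normSq_apply]
    have : (π * v : ℂ) = ((π * v.re : ℝ) : ℂ) + ((π * v.im : ℝ) : ℂ) * I := by
      apply Complex.ext <;> simp
    rw [this, Complex.sin_add_mul_I, ← Complex.ofReal_sin, ← Complex.ofReal_cos,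
      ← Complex.ofReal_sinh, ← Complex.ofReal_cosh]
    simp only [Complex.add_re, Complex.mul_re, Complex.add_im, Complex.mul_im, Complex.ofReal_re,
      Complex.ofReal_im, Complex.I_re, Complex.I_im]
    have a1 := Real.cosh_sq (π * v.im)
    have a2 := Real.sin_sq_add_cos_sq (π * v.re)
    generalize Real.cosh (π * v.im) = A at *
    generalize Real.sinh (π * v.im) = B at *
    generalize Real.sin (π * v.re) = C at *
    generalize Real.cos (π * v.re) = D at *
    linear_combination C^2 * a1 + B^2 * a2
  have h6 : ‖v‖ ^ 2 = v.re ^ 2 + v.im ^ 2 := by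
    rw [Complex.sq_norm, Complex.normSq_apply]; ring
  have hpi := Real.pi_gt_three
  have h7 : v.re ^ 2 ≤ Real.sin (π * v.re) ^ 2 := by
    have := @Real.mul_abs_le_abs_sin (π * v.re) (by
      rw [abs_mul, abs_of_pos Real.pi_pos]; nlinarith)
    rw [abs_mul, abs_of_pos Real.pi_pos] at this
    have h8 : 2 / π * (π * |v.re|) = 2 * |v.re| := by field_simp
    rw [h8] at this
    apply sq_le_sq.2
    linarith [abs_nonneg v.re]
  have h8 : v.im ^ 2 ≤ Real.sinh (π * v.im) ^ 2 := by
    apply sq_le_sq.2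
    rw [Real.abs_sinh]
    have : |π * v.im| ≤ Real.sinh |π * v.im| := Real.self_le_sinh_iff.2 (abs_nonneg _)
    refine le_trans ?_ this
    rw [abs_mul, abs_of_pos Real.pi_pos]
    nlinarith [abs_nonneg v.im]
  have h9 : ‖v‖ ^ 2 ≤ ‖Complex.sin (π * v)‖ ^ 2 := by rw [h5, h6]; linarith
  have := (sq_le_sq₀ (norm_nonneg _) (norm_nonneg _)).1 h9
  linarith
lemma szc_euler_odd (n : ℕ) (h : n % 2 = 1) : eulerNumber n = 0 := by
  cases n with
  | zero => simp at h
  | succ n => rw [eulerNumber, if_pos h]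

lemma szc_euler_even (n : ℕ) (hn : 0 < n) :
    ∑ k ∈ Finset.range (n + 1), ((2 * n).choose (2 * k) : ℚ) * eulerNumber (2 * k) = 0 := by
  rw [Finset.sum_range_succ]
  obtain ⟨m, hm⟩ : ∃ m, 2 * n = m + 1 := ⟨2 * n - 1, by omega⟩
  have h : eulerNumber (2 * n) = -∑ k ∈ Finset.range n,
      ((2 * n).choose (2 * k) : ℚ) * eulerNumber (2 * k) := by
    rw [hm, eulerNumber, if_neg (by omega), ← hm]
    have : 2 * n / 2 = n := by omega
    rw [this]
    congr 1
    exact Finset.sum_attach (Finset.range n)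
      (fun k => ((2 * n).choose (2 * k) : ℚ) * eulerNumber (2 * k))
  rw [h]
  simp

/-- even-index sum -/
lemma szc_sum_even (n : ℕ) (f : ℕ → ℚ) :
    ∑ j ∈ Finset.range (2 * n + 1), (if j % 2 = 0 then f j else 0) =
      ∑ k ∈ Finset.range (n + 1), f (2 * k) := by
  induction n with
  | zero => simp
  | succ n ih =>
    rw [show 2 * (n + 1) + 1 = 2 * n + 1 + 1 + 1 by ring, Finset.sum_range_succ,
      Finset.sum_range_succ, ih, Finset.sum_range_succ _ (n + 1),
      if_neg (by omega), if_pos (by omega)]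
    simp [mul_add]

/-- exponential generating function of Euler numbers -/
noncomputable def szcE : PowerSeries ℂ :=
  PowerSeries.mk fun n => (eulerNumber n : ℂ) / (n.factorial : ℂ)

noncomputable def szcExp (c : ℂ) : PowerSeries ℂ :=
  PowerSeries.mk fun n => c ^ n / (n.factorial : ℂ)

lemma szcExp_mul (a b : ℂ) : szcExp a * szcExp b = szcExp (a + b) := by
  ext n
  simp only [szcExp, PowerSeries.coeff_mul, PowerSeries.coeff_mk]
  rw [(Commute.all a b).add_pow', Finset.sum_div]
  apply Finset.sum_congr rfl
  intro p hp
  have := Finset.HasAntidiagonal.mem_antidiagonal.1 hp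
  subst this
  have h1 : ((p.1 + p.2).factorial : ℂ) ≠ 0 := by exact_mod_cast Nat.factorial_ne_zero _
  have h2 : ((p.1).factorial : ℂ) ≠ 0 := by exact_mod_cast Nat.factorial_ne_zero _
  have h3 : ((p.2).factorial : ℂ) ≠ 0 := by exact_mod_cast Nat.factorial_ne_zero _
  have h4 := Nat.add_choose_mul_factorial_mul_factorial p.1 p.2
  rw [← Nat.choose_symm_add] at h4
  have h5 : ((p.1 + p.2).choose p.1 : ℂ) * p.1.factorial * p.2.factorial = (p.1 + p.2).factorial := by
    exact_mod_cast h4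
  rw [nsmul_eq_mul]
  field_simp
  rw [← h5]; ring

lemma szcExp_zero : szcExp 0 = 1 := by
  ext n
  cases n <;> simp [szcExp, PowerSeries.coeff_one]

lemma szcExp_rescale (a b : ℂ) : PowerSeries.rescale a (szcExp b) = szcExp (a * b) := by
  ext n
  simp [szcExp, PowerSeries.coeff_rescale, mul_pow, mul_div_assoc]

lemma szcE_mul : szcE * (szcExp 1 + szcExp (-1)) = 2 := by
  ext n
  have h2c : (PowerSeries.coeff n) (2 : PowerSeries ℂ) = if n = 0 then 2 else 0 := by
    have : (2 : PowerSeries ℂ) = PowerSeries.C 2 := (map_ofNat PowerSeries.C 2).symm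
    rw [this, PowerSeries.coeff_C]
  rw [h2c, PowerSeries.coeff_mul]
  simp only [szcE, szcExp, map_add, PowerSeries.coeff_mk, one_pow]
  rw [Finset.Nat.sum_antidiagonal_eq_sum_range_succ
    (fun i j => (eulerNumber i : ℂ) / (i.factorial : ℂ) *
      (1 / (j.factorial : ℂ) + (-1) ^ j / (j.factorial : ℂ)))]
  by_cases hn : n % 2 = 1
  · rw [if_neg (by omega)]
    apply Finset.sum_eq_zero
    intro i hi
    have hi' := Finset.mem_range.1 hi
    by_cases h : i % 2 = 1
    · simp [szc_euler_odd i h]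
    · have : Odd (n - i) := by rw [Nat.odd_iff]; omega
      rw [this.neg_one_pow]; ring
  · obtain ⟨m, rfl⟩ : ∃ m, n = 2 * m := ⟨n / 2, by omega⟩
    have key : ∀ i ∈ Finset.range (2 * m).succ, (eulerNumber i : ℂ) / (i.factorial : ℂ) *
      (1 / ((2 * m - i).factorial : ℂ) + (-1) ^ (2 * m - i) / ((2 * m - i).factorial : ℂ)) =
      2 / ((2 * m).factorial : ℂ) * (((if i % 2 = 0 then ((2 * m).choose i : ℚ) * eulerNumber i else 0 : ℚ)) : ℂ) := by
      intro i hi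
      have hi' := Finset.mem_range.1 hi
      by_cases h : i % 2 = 0
      · rw [if_pos h]
        have : Even (2 * m - i) := by rw [Nat.even_iff]; omega
        rw [this.neg_one_pow]
        have h5 : ((2 * m).choose i : ℂ) * i.factorial * (2 * m - i).factorial = (2 * m).factorial := by
          exact_mod_cast Nat.choose_mul_factorial_mul_factorial (by omega : i ≤ 2 * m)
        have h1 : ((2 * m).factorial : ℂ) ≠ 0 := by exact_mod_cast Nat.factorial_ne_zero _
        have h2 : ((i).factorial : ℂ) ≠ 0 := by exact_mod_cast Nat.factorial_ne_zero _
        have h3 : ((2 * m - i).factorial : ℂ) ≠ 0 := by exact_mod_cast Nat.factorial_ne_zero _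
        push_cast
        field_simp
        rw [← h5]; ring
      · rw [if_neg h, szc_euler_odd i (by omega)]; simp
    rw [Finset.sum_congr rfl key, ← Finset.mul_sum, ← Rat.cast_sum, Nat.succ_eq_add_one,
      szc_sum_even m (fun i => ((2 * m).choose i : ℚ) * eulerNumber i)]
    by_cases hm : m = 0
    · subst hm; simp [eulerNumber]
    · rw [szc_euler_even m (by omega), if_neg (by omega)]; simp

noncomputable def szcC : PowerSeries ℂ :=
  PowerSeries.mk fun n => (2 - 2 ^ n) * (bernoulli n : ℂ) / (n.factorial : ℂ)

lemma szcC_mul : szcC * (szcExp 1 - szcExp (-1)) = 2 * PowerSeries.X := by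
  have hB := bernoulliPowerSeries_mul_exp_sub_one ℂ
  have hexp : PowerSeries.exp ℂ = szcExp 1 := by
    ext n; simp [szcExp, PowerSeries.coeff_exp]
  rw [hexp] at hB
  have hB2 := congrArg (PowerSeries.rescale (2:ℂ)) hB
  rw [map_mul, map_sub, szcExp_rescale, map_one, PowerSeries.rescale_X] at hB2
  have hC : szcC = 2 * bernoulliPowerSeries ℂ - PowerSeries.rescale (2:ℂ) (bernoulliPowerSeries ℂ) := by
    ext n
    have : (2 : PowerSeries ℂ) = PowerSeries.C 2 := (map_ofNat PowerSeries.C 2).symm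
    simp only [szcC, bernoulliPowerSeries, this, PowerSeries.coeff_mk, map_sub, PowerSeries.coeff_C_mul,
      PowerSeries.coeff_rescale]
    simp
    ring
  have e1 : szcExp 1 * szcExp (-1) = 1 := by rw [szcExp_mul]; simp [szcExp_zero]
  have e2 : szcExp (2 * 1) = szcExp 1 * szcExp 1 := by rw [szcExp_mul]; congr 1; norm_num
  rw [e2] at hB2
  have hC2 : (PowerSeries.C (2:ℂ)) = 2 := map_ofNat PowerSeries.C 2
  rw [hC2] at hB2
  rw [hC]
  generalize PowerSeries.rescale (2:ℂ) (bernoulliPowerSeries ℂ) = B2 at *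
  generalize bernoulliPowerSeries ℂ = B at *
  generalize szcExp (-1) = F at *
  generalize szcExp 1 = G at *
  -- multiply by F the identity (2B - B2)(G^2-1) = 2 X G
  linear_combination (2 * G * F + 2 * F) * hB - F * hB2 + (-(2 * B - B2) * G + 2 * PowerSeries.X) * e1

/-- Taylor series at zero -/
noncomputable def szcT (f : ℂ → ℂ) : PowerSeries ℂ :=
  PowerSeries.mk fun n => iteratedDeriv n f 0 / (n.factorial : ℂ)

lemma szcT_mul (f g : ℂ → ℂ) (hf : AnalyticAt ℂ f 0) (hg : AnalyticAt ℂ g 0) :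
    szcT (fun w => f w * g w) = szcT f * szcT g := by
  ext n
  rw [PowerSeries.coeff_mul]
  simp only [szcT, PowerSeries.coeff_mk]
  rw [iteratedDeriv_fun_mul hf.contDiffAt hg.contDiffAt,
    Finset.Nat.sum_antidiagonal_eq_sum_range_succ
    (fun i j => iteratedDeriv i f 0 / (i.factorial : ℂ) * (iteratedDeriv j g 0 / (j.factorial : ℂ))),
    Finset.sum_div]
  apply Finset.sum_congr rfl
  intro i hi
  have hi' := Finset.mem_range.1 hi
  have h5 : ((n).choose i : ℂ) * i.factorial * (n - i).factorial = (n).factorial := by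
    exact_mod_cast Nat.choose_mul_factorial_mul_factorial (by omega : i ≤ n)
  have h1 : ((n).factorial : ℂ) ≠ 0 := by exact_mod_cast Nat.factorial_ne_zero _
  have h2 : ((i).factorial : ℂ) ≠ 0 := by exact_mod_cast Nat.factorial_ne_zero _
  have h3 : ((n - i).factorial : ℂ) ≠ 0 := by exact_mod_cast Nat.factorial_ne_zero _
  field_simp
  rw [← h5]; ring

lemma szcT_add (f g : ℂ → ℂ) (hf : AnalyticAt ℂ f 0) (hg : AnalyticAt ℂ g 0) :
    szcT (fun w => f w + g w) = szcT f + szcT g := by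
  ext n
  simp only [szcT, PowerSeries.coeff_mk, map_add]
  rw [iteratedDeriv_fun_add hf.contDiffAt hg.contDiffAt, add_div]

lemma szcT_exp (c : ℂ) : szcT (fun w => Complex.exp (c * w)) = szcExp c := by
  ext n
  simp [szcT, szcExp, iteratedDeriv_cexp_const_mul]

lemma szcT_const (c : ℂ) : szcT (fun _ => c) = PowerSeries.C c := by
  ext n
  simp only [szcT, PowerSeries.coeff_mk, PowerSeries.coeff_C, iteratedDeriv_const]
  split_ifs with h
  · simp [h]
  · simp

lemma szcT_id : szcT (fun w => w) = PowerSeries.X := by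
  ext n
  simp only [szcT, PowerSeries.coeff_mk, PowerSeries.coeff_X]
  rcases n with _ | _ | n
  · simp
  · simp
  · rw [iteratedDeriv_succ']
    simp [iteratedDeriv_const]

lemma szcT_congr (f g : ℂ → ℂ) (h : f =ᶠ[nhds 0] g) : szcT f = szcT g := by
  ext n
  simp only [szcT, PowerSeries.coeff_mk]
  rw [h.iteratedDeriv_eq]

lemma szcT_bigO (f : ℂ → ℂ) (hf : AnalyticAt ℂ f 0) (n : ℕ) :
    (fun w => f w - ∑ j ∈ Finset.range n, PowerSeries.coeff j (szcT f) * w ^ j)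
      =O[nhds 0] fun w => ‖w‖ ^ n := by
  have := (hf.hasFPowerSeriesAt).isBigO_sub_partialSum_pow n
  simp only [zero_add] at this
  refine this.congr_left ?_
  intro w
  congr 1
  simp [FormalMultilinearSeries.partialSum, szcT, FormalMultilinearSeries.ofScalars]

lemma szc_phi (z : ℂ) (hz : z ≠ 0) : ∃ Φ : ℂ → ℂ, AnalyticAt ℂ Φ 0 ∧
    (∀ w, w ≠ 0 → Φ w = π * z * w / (Complex.sin (π * z * w) * Complex.cos (π * w))) ∧
    szcT Φ = PowerSeries.rescale (π * I) szcE * PowerSeries.rescale (π * I * z) szcC := by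
  have hpi : (π : ℂ) ≠ 0 := by exact_mod_cast Real.pi_ne_zero
  set S : ℂ → ℂ := fun w => Complex.sin (π * z * w) with hS
  set K : ℂ → ℂ := fun w => Complex.cos (π * w) with hK
  have hSa : AnalyticAt ℂ S 0 := by
    apply Differentiable.analyticAt
    fun_prop
  have hKa : AnalyticAt ℂ K 0 := by
    apply Differentiable.analyticAt
    fun_prop
  set s := dslope S 0 with hs
  have hsa : AnalyticAt ℂ s 0 := by
    obtain ⟨p, hp⟩ := hSa
    exact (hp.has_fpower_series_dslope_fslope).analyticAt
  have hs0 : s 0 = π * z := by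
    rw [hs, dslope_same]
    have : HasDerivAt S (Complex.cos (π * z * 0) * (π * z * 1)) 0 :=
      ((hasDerivAt_id (0:ℂ)).const_mul (π * z)).csin
    rw [this.deriv]; simp
  have hsw : ∀ w, w * s w = S w := by
    intro w
    have := sub_smul_dslope S 0 w
    simpa [hS] using this
  have hne : ∀ᶠ w in nhds (0:ℂ), s w * K w ≠ 0 := by
    have hc : ContinuousAt (fun w => s w * K w) 0 := hsa.continuousAt.mul hKa.continuousAt
    apply hc.eventually_ne
    simp [hs0, hK, hpi, hz]
  have hne0 := hne.self_of_nhds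
  have hΦa : AnalyticAt ℂ (fun w => π * z / (s w * K w)) 0 :=
    analyticAt_const.div (hsa.mul hKa) hne0
  refine ⟨fun w => π * z / (s w * K w), hΦa, ?_, ?_⟩
  · intro w hw
    show π * z / (s w * K w) = π * z * w / (S w * K w)
    rw [← hsw w]
    rw [mul_assoc w, mul_comm (π * z) w, mul_div_mul_left _ _ hw]
  · set TΦ := szcT (fun w => π * z / (s w * K w)) with hT
    have e1 : TΦ * (szcT s * szcT K) = PowerSeries.C (π * z) := by
      rw [hT, ← szcT_mul s K hsa hKa, ← szcT_mul _ (fun w => s w * K w) hΦa (hsa.mul hKa), ← szcT_const]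
      apply szcT_congr
      filter_upwards [hne] with w hw
      exact div_mul_cancel₀ _ hw
    have e2 : PowerSeries.X * szcT s = szcT S := by
      rw [← szcT_id, ← szcT_mul (fun w => w) _ analyticAt_id hsa]
      congr 1
      funext w
      exact hsw w
    have hexpa : ∀ c : ℂ, AnalyticAt ℂ (fun w => Complex.exp (c * w)) 0 := by
      intro c
      apply Differentiable.analyticAt
      fun_prop
    have e3 : PowerSeries.C 2 * szcT K = szcExp (π * I) + szcExp (-(π * I)) := by
      rw [← szcT_const, ← szcT_mul _ _ analyticAt_const hKa, ← szcT_exp, ← szcT_exp,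
        ← szcT_add _ _ (hexpa _) (hexpa _)]
      congr 1
      funext w
      simp only [hK, Complex.cos]
      rw [show (π * w * I : ℂ) = π * I * w by ring, show (-(π * w) * I : ℂ) = -(π * I) * w by ring]
      ring
    have e4 : PowerSeries.C (2 * I) * szcT S + szcExp (-(π * I * z)) = szcExp (π * I * z) := by
      rw [← szcT_const, ← szcT_mul _ _ analyticAt_const hSa, ← szcT_exp, ← szcT_exp,
        ← szcT_add (fun w => 2 * I * S w) _ (analyticAt_const.mul hSa) (hexpa _)]
      congr 1
      funext w
      simp only [hS, Complex.sin]
      rw [show (π * z * w * I : ℂ) = π * I * z * w by ring,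
        show (-(π * z * w) * I : ℂ) = -(π * I * z) * w by ring]
      linear_combination (Complex.exp (-(π * I * z) * w) - Complex.exp (π * I * z * w)) * Complex.I_sq
    have f1 := congrArg (PowerSeries.rescale (π * I : ℂ)) szcE_mul
    rw [map_mul, map_add, szcExp_rescale, szcExp_rescale, map_ofNat, mul_one, mul_neg_one, ← e3] at f1
    have f2 := congrArg (PowerSeries.rescale (π * I * z : ℂ)) szcC_mul
    rw [map_mul, map_sub, szcExp_rescale, szcExp_rescale, map_mul, map_ofNat, mul_one, mul_neg_one, ← e4,
      ← e2, PowerSeries.rescale_X] at f2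
    set RE := PowerSeries.rescale (π * I : ℂ) szcE
    set RC := PowerSeries.rescale (π * I * z : ℂ) szcC
    have c2 : (PowerSeries.C (2:ℂ)) = 2 := map_ofNat PowerSeries.C 2
    have f1' : RE * szcT K = 1 := by
      have h2 : (PowerSeries.C (2:ℂ)) ≠ 0 := by
        intro h
        have := congrArg (PowerSeries.coeff 0) h
        simp at this
      apply mul_left_cancel₀ h2
      rw [mul_one]
      linear_combination f1 - c2
    have f2' : RC * szcT s = PowerSeries.C (π * z) := by
      have h2 : (PowerSeries.C (2 * I:ℂ)) * PowerSeries.X ≠ 0 := by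
        intro h
        have := congrArg (PowerSeries.coeff 1) h
        simp at this
      apply mul_left_cancel₀ h2
      have h3 : (PowerSeries.C (2 * I:ℂ)) * PowerSeries.C (π * z) = 2 * PowerSeries.C (π * I * z) := by
        rw [← c2, ← map_mul, ← map_mul]
        congr 1; ring
      linear_combination f2 - PowerSeries.X * h3
    have hnz : szcT s * szcT K ≠ 0 := by
      intro h
      rw [h, mul_zero] at e1
      have := congrArg (PowerSeries.coeff 0) e1
      simp [hpi, hz] at this
    apply mul_right_cancel₀ hnz
    rw [e1]
    linear_combination (-RC * szcT s) * f1' - f2'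

lemma szc_coeff (z : ℂ) (hz : z ≠ 0) (k : ℕ) :
    PowerSeries.coeff k (PowerSeries.rescale (π * I) szcE * PowerSeries.rescale (π * I * z) szcC) =
    -2 * z * (((π : ℂ) * Complex.I) ^ k / (k.factorial : ℂ) *
        ∑ m ∈ Finset.range (k + 1),
          ((2 : ℂ) ^ ((m : ℤ) - 1) - 1) * (bernoulli m : ℂ) * (eulerNumber (k - m) : ℂ) *
            (k.choose m : ℂ) * (z ^ ((m : ℤ) - 1))) := by
  rw [mul_comm, PowerSeries.coeff_mul]
  simp only [PowerSeries.coeff_rescale, szcE, szcC, PowerSeries.coeff_mk]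
  rw [Finset.Nat.sum_antidiagonal_eq_sum_range_succ
    (fun i j => (π * I * z) ^ i * ((2 - 2 ^ i) * (bernoulli i : ℂ) / (i.factorial : ℂ)) *
      ((π * I) ^ j * ((eulerNumber j : ℂ) / (j.factorial : ℂ)))), Finset.mul_sum, Finset.mul_sum]
  apply Finset.sum_congr rfl
  intro i hi
  have hi' := Finset.mem_range.1 hi
  have h5 : ((k).choose i : ℂ) * i.factorial * (k - i).factorial = (k).factorial := by
    exact_mod_cast Nat.choose_mul_factorial_mul_factorial (by omega : i ≤ k)
  have h1 : ((k).factorial : ℂ) ≠ 0 := by exact_mod_cast Nat.factorial_ne_zero _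
  have h2 : ((i).factorial : ℂ) ≠ 0 := by exact_mod_cast Nat.factorial_ne_zero _
  have h3 : ((k - i).factorial : ℂ) ≠ 0 := by exact_mod_cast Nat.factorial_ne_zero _
  have h6 : (π * I : ℂ) ^ k = (π * I) ^ i * (π * I) ^ (k - i) := by
    rw [← pow_add]; congr 1; omega
  rw [zpow_sub_one₀ hz, zpow_sub_one₀ two_ne_zero, zpow_natCast, zpow_natCast, mul_pow _ z, h6]
  generalize (π * I : ℂ) ^ i = A
  generalize (π * I : ℂ) ^ (k - i) = B
  field_simp
  rw [← h5]; ring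
lemma szc_chi (n : ℕ) : chiFour n = Real.sin (π * n / 2) := by
  have h : (n : ℝ) = 4 * ((n / 4 : ℕ) : ℝ) + ((n % 4 : ℕ) : ℝ) := by
    exact_mod_cast (Nat.div_add_mod n 4).symm
  have h2 : π * n / 2 = π * ((n % 4 : ℕ) : ℝ) / 2 + ((n / 4 : ℕ) : ℝ) * (2 * π) := by
    rw [h]; ring_nf
  rw [h2, Real.sin_add_nat_mul_two_pi, chiFour]
  have h4 : n % 4 < 4 := Nat.mod_lt _ (by norm_num)
  generalize n % 4 = m at h4
  interval_cases m
  · simp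
  · simp
  · simp
  · have : π * ((3 : ℕ) : ℝ) / 2 = π / 2 + π := by push_cast; ring
    rw [this, Real.sin_add_pi]; simp

lemma szc_radius (z : ℝ) (hz : z ≠ 0) : ∃ δ : ℝ, 0 < δ ∧ ∀ N : ℕ, ∃ R : ℝ, (N : ℝ) ≤ R ∧ 0 < R ∧
    (∀ n : ℤ, δ ≤ |R - n / 2|) ∧ (∀ n : ℤ, δ ≤ |R - n / z|) := by
  have hl : 0 < 1 / |z| := by positivity
  set l := 1 / |z| with hldef
  set ε := min (1 / 8) (l / 2) with hε
  have hε0 : 0 < ε := by rw [hε]; positivity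
  have hε1 : ε ≤ 1 / 8 := min_le_left _ _
  have hε2 : ε ≤ l / 2 := min_le_right _ _
  have half : ∀ (N : ℕ) (e : ℝ), 0 ≤ e → e ≤ 1 / 8 → ∀ n : ℤ, ε / 4 ≤ |(N : ℝ) + 1 / 4 + e - n / 2| := by
    intro N e he0 he1 n
    have : n ≤ 2 * (N : ℤ) ∨ 2 * (N : ℤ) + 1 ≤ n := by omega
    rcases this with h | h
    · have h' : (n : ℝ) ≤ 2 * N := by exact_mod_cast h
      rw [le_abs]; left; linarith
    · have h' : 2 * (N : ℝ) + 1 ≤ n := by exact_mod_cast h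
      rw [le_abs]; right; linarith
  refine ⟨ε / 4, by positivity, fun N => ?_⟩
  by_cases h : ∀ n : ℤ, ε / 4 ≤ |(N : ℝ) + 1 / 4 - n / z|
  · refine ⟨N + 1 / 4, by linarith, by positivity, ?_, h⟩
    intro n
    simpa using half N 0 le_rfl (by norm_num) n
  · push Not at h
    obtain ⟨p, hp⟩ := h
    refine ⟨N + 1 / 4 + ε, by linarith, by positivity, half N ε hε0.le hε1, ?_⟩
    intro q
    by_contra hq
    push Not at hq
    have h1 : |((q - p : ℤ) : ℝ) / z - ε| < ε / 2 := by
      have : ((q - p : ℤ) : ℝ) / z - ε =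
          ((N : ℝ) + 1 / 4 - p / z) - ((N : ℝ) + 1 / 4 + ε - q / z) := by
        push_cast; ring
      rw [this]
      have := abs_sub ((N : ℝ) + 1 / 4 - p / z) ((N : ℝ) + 1 / 4 + ε - q / z)
      linarith
    by_cases hpq : q - p = 0
    · rw [hpq] at h1
      simp [abs_of_pos hε0] at h1
      linarith
    · have h2 : (1 : ℝ) ≤ |((q - p : ℤ) : ℝ)| := by
        exact_mod_cast Int.one_le_abs hpq
      have h3 : l ≤ |((q - p : ℤ) : ℝ) / z| := by
        rw [abs_div, hldef]
        gcongr
      have h4 := abs_sub_abs_le_abs_sub (((q - p : ℤ) : ℝ) / z) ε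
      rw [abs_of_pos hε0] at h4
      linarith

lemma szc_sum_sym (g : ℤ → ℂ) (h0 : g 0 = 0) (hev : ∀ n, g (-n) = g n) (M : ℕ) :
    ∑ n ∈ Finset.Icc (-(M : ℤ)) M, g n = 2 * ∑ n ∈ Finset.range M, g ((n : ℤ) + 1) := by
  induction M with
  | zero => simp [h0]
  | succ M ih =>
    have : Finset.Icc (-((M + 1 : ℕ) : ℤ)) ((M + 1 : ℕ) : ℤ) =
        insert (-((M + 1 : ℕ) : ℤ)) (insert ((M + 1 : ℕ) : ℤ) (Finset.Icc (-(M : ℤ)) M)) := by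
      ext x
      simp only [Finset.mem_insert, Finset.mem_Icc]
      omega
    rw [this, Finset.sum_insert, Finset.sum_insert, ih, Finset.sum_range_succ, hev]
    · push_cast; ring
    · simp
    · simp only [Finset.mem_insert, Finset.mem_Icc]
      omega

lemma szc_inv_lim (F : ℂ → ℂ) (F' a : ℂ) (h : HasDerivAt F F' a) (h0 : F a = 0) (hF : F' ≠ 0) :
    Filter.Tendsto (fun w => (w - a) / F w) (nhdsWithin a {a}ᶜ) (nhds F'⁻¹) := by
  have := (hasDerivAt_iff_tendsto_slope.1 h).inv₀ hF
  refine this.congr ?_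
  intro w
  rw [slope_def_field, h0, sub_zero, inv_div]
  
lemma szc_dist (z : ℝ) (R δ : ℝ) (hR : 0 < R) (h : ∀ n : ℤ, δ ≤ |R - n / z|) (w : ℂ) (hw : ‖w‖ = R) (n : ℤ) :
    δ ≤ ‖w - n / z‖ := by
  have h1 : |‖w‖ - ‖(n : ℂ) / z‖| ≤ ‖w - n / z‖ := abs_norm_sub_norm_le _ _
  refine le_trans ?_ h1
  have h2 : ‖(n : ℂ) / z‖ = |(n : ℝ) / z| := by
    rw [← Complex.ofReal_intCast, ← Complex.ofReal_div, Complex.norm_real, Real.norm_eq_abs]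
  rw [h2, hw]
  rcases abs_choice ((n : ℝ) / z) with h3 | h3
  · rw [h3]; exact h n
  · rw [h3]
    have := h (-n)
    push_cast at this
    rwa [neg_div] at this

/-- the bound on good circles -/
lemma szc_bound (z : ℝ) (hz : z ≠ 0) (δ : ℝ) (hδ : 0 < δ) (k : ℕ) : ∃ C : ℝ, ∀ R : ℝ, 0 < R →
    (∀ n : ℤ, δ ≤ |R - n / 2|) → (∀ n : ℤ, δ ≤ |R - n / z|) → ∀ w ∈ Metric.sphere (0:ℂ) R,
    ‖(π * z : ℂ) / (Complex.sin (π * z * w) * Complex.cos (π * w) * w ^ k)‖ ≤ C / R ^ k := by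
  refine ⟨π * |z| / ((|z| * δ / 2) * (δ / 2)), ?_⟩
  intro R hR h1 h2 w hw
  have hw' : ‖w‖ = R := by simpa using hw
  have hzp : 0 < |z| := abs_pos.2 hz
  have hzc : (z : ℂ) ≠ 0 := by exact_mod_cast hz
  have hs : |z| * δ / 2 ≤ ‖Complex.sin (π * z * w)‖ := by
    rw [mul_assoc]
    apply szc_sin_lower _ (by positivity)
    intro n
    have := szc_dist z R δ hR h2 w hw' n
    have e : (z * w - n : ℂ) = z * (w - n / z) := by field_simp
    rw [e, norm_mul, Complex.norm_real, Real.norm_eq_abs]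
    gcongr
  have hc : δ / 2 ≤ ‖Complex.cos (π * w)‖ := by
    rw [← Complex.sin_add_pi_div_two, show (π * w + π / 2 : ℂ) = π * (w + 1 / 2) by ring]
    apply szc_sin_lower _ (by positivity)
    intro n
    have := szc_dist 2 R δ hR h1 w hw' (2 * n - 1)
    convert this using 2
    push_cast; ring
  rw [norm_div, norm_mul, norm_mul, norm_mul, norm_pow, hw', Complex.norm_real, Complex.norm_real,
    Real.norm_eq_abs, Real.norm_eq_abs, abs_of_pos Real.pi_pos, div_div]
  gcongr

lemma szc_circle (z : ℝ) (hirr : Irrational z) (k : ℕ) (hk : 0 < k) (R : ℝ) (hR : 0 < R)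
    (δ : ℝ) (hδ : 0 < δ)
    (h1 : ∀ n : ℤ, δ ≤ |R - n / 2|) (h2 : ∀ n : ℤ, δ ≤ |R - n / z|) :
    (∮ w in C(0, R), (π * z : ℂ) / (Complex.sin (π * z * w) * Complex.cos (π * w) * w ^ k)) =
    2 * π * I * (PowerSeries.coeff k (PowerSeries.rescale (π * I) szcE *
        PowerSeries.rescale (π * I * z) szcC) +
      ∑ n ∈ Finset.Icc (-(⌊R * |z|⌋₊ : ℤ)) ⌊R * |z|⌋₊,
        (1 / (Complex.cos (π * n) * Complex.cos (π * (n / z)) * (n / z) ^ k) : ℂ) +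
      ∑ n ∈ Finset.Icc (-(⌊R * 2⌋₊ : ℤ)) ⌊R * 2⌋₊,
        (-z * Complex.sin (π * (n / 2)) / (Complex.sin (π * z * (n / 2)) * (n / 2) ^ k) : ℂ)) := by
  have hz : z ≠ 0 := hirr.ne_zero
  have hzp : 0 < |z| := abs_pos.2 hz
  have hzc : (z : ℂ) ≠ 0 := by exact_mod_cast hz
  have hpi : (π : ℂ) ≠ 0 := by exact_mod_cast Real.pi_ne_zero
  have hirr' : ∀ a b : ℤ, b ≠ 0 → (z : ℂ) * b ≠ a := by
    intro a b hb h
    have h' : z * b = a := by exact_mod_cast h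
    have hb' : (b : ℝ) ≠ 0 := by exact_mod_cast hb
    apply hirr
    refine ⟨(a : ℚ) / b, ?_⟩
    push_cast
    rw [← h']; field_simp
  obtain ⟨Φ, hΦa, hΦ, hΦT⟩ := szc_phi z hzc
  set Q := PowerSeries.rescale (π * I : ℂ) szcE * PowerSeries.rescale (π * I * z : ℂ) szcC with hQ
  set f : ℂ → ℂ := fun w => (π * z : ℂ) / (Complex.sin (π * z * w) * Complex.cos (π * w) * w ^ k) with hf
  set P : ℂ → ℂ := fun w => ∑ j ∈ Finset.range (k + 1),
    PowerSeries.coeff j Q * (w - 0) ^ ((j : ℤ) - (k + 1)) with hP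
  set M := ⌊R * |z|⌋₊ with hM
  set L := ⌊R * 2⌋₊ with hL
  -- poles and residues
  let a : ℤ ⊕ ℤ → ℂ := Sum.elim (fun n => (n : ℂ) / z) (fun n => (n : ℂ) / 2)
  let r : ℤ ⊕ ℤ → ℂ := Sum.elim
    (fun n => (1 / (Complex.cos (π * n) * Complex.cos (π * (n / z)) * (n / z) ^ k) : ℂ))
    (fun n => (-z * Complex.sin (π * (n / 2)) / (Complex.sin (π * z * (n / 2)) * (n / 2) ^ k) : ℂ))
  let s : Finset (ℤ ⊕ ℤ) := (Finset.Icc (-(M : ℤ)) M).disjSum ((Finset.Icc (-(L : ℤ)) L).erase 0)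
  have hPd : ∀ w : ℂ, w ≠ 0 → DifferentiableAt ℂ P w := by
    intro w hw
    apply DifferentiableAt.fun_sum
    intro j _
    apply DifferentiableAt.const_mul
    apply DifferentiableAt.zpow (by fun_prop)
    left; simpa using hw
  have hfd : ∀ w : ℂ, w ≠ 0 → Complex.sin (π * z * w) ≠ 0 → Complex.cos (π * w) ≠ 0 →
      DifferentiableAt ℂ f w := by
    intro w h1 h2 h3
    apply DifferentiableAt.div (by fun_prop) (by fun_prop)
    exact mul_ne_zero (mul_ne_zero h2 h3) (pow_ne_zero _ h1)
  have hs0 : Sum.inl 0 ∈ s := by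
    simp [s]
  -- membership from norms
  have hmem : ∀ (x : ℝ) (n : ℤ), |(n : ℝ)| ≤ x → n ∈ Finset.Icc (-(⌊x⌋₊ : ℤ)) ⌊x⌋₊ := by
    intro x n hn
    rw [Finset.mem_Icc]
    have : n.natAbs ≤ ⌊x⌋₊ := by
      apply Nat.le_floor
      rw [Nat.cast_natAbs]; push_cast; exact hn
    omega
  have hmem' : ∀ (x : ℝ) (n : ℤ), 0 ≤ x → n ∈ Finset.Icc (-(⌊x⌋₊ : ℤ)) ⌊x⌋₊ → |(n : ℝ)| ≤ x := by
    intro x n hx hn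
    rw [Finset.mem_Icc] at hn
    have h1 : (n.natAbs : ℝ) ≤ (⌊x⌋₊ : ℝ) := by
      have : n.natAbs ≤ ⌊x⌋₊ := by omega
      exact_mod_cast this
    rw [Nat.cast_natAbs] at h1; push_cast at h1
    exact h1.trans (Nat.floor_le hx)
  have hnorm : ∀ (y : ℝ) (n : ℤ), ‖(n : ℂ) / y‖ = |(n : ℝ)| / |y| := by
    intro y n
    rw [← Complex.ofReal_intCast, ← Complex.ofReal_div, Complex.norm_real, Real.norm_eq_abs, abs_div]
  have hball : ∀ (y : ℝ) (n : ℤ), y ≠ 0 → (∀ n : ℤ, δ ≤ |R - n / y|) →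
      n ∈ Finset.Icc (-(⌊R * |y|⌋₊ : ℤ)) ⌊R * |y|⌋₊ → (n : ℂ) / y ∈ Metric.ball (0:ℂ) R := by
    intro y n hy h hn
    have hyp : 0 < |y| := abs_pos.2 hy
    have h3 := hmem' _ n (by positivity) hn
    rw [mem_ball_zero_iff]
    have h4 : ‖(n : ℂ) / y‖ ≤ R := by
      rw [hnorm, div_le_iff₀ hyp]; exact h3
    refine lt_of_le_of_ne h4 ?_
    intro h5
    have := szc_dist y R δ hR h _ h5 n
    simp at this
    linarith
  have hnz : ∀ i ∈ s, a i = 0 → i = Sum.inl 0 := by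
    rintro (n | n) hi h
    · have : (n : ℂ) / z = 0 := h
      rw [div_eq_zero_iff] at this
      rcases this with h | h
      · have : n = 0 := by exact_mod_cast h
        rw [this]
      · exact absurd h hzc
    · have : (n : ℂ) / 2 = 0 := h
      have h3 : n = 0 := by
        simpa using this
      simp [s, h3] at hi
  have key := szc_residue_sum a r R hR s (fun w => f w - P w) ?_ ?_ ?_ ?_
  · -- finish
    have hci : CircleIntegrable f 0 R := by
      apply ContinuousOn.circleIntegrable hR.le
      intro w hw
      apply ContinuousAt.continuousWithinAt
      apply DifferentiableAt.continuousAt (𝕜 := ℂ)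
      have hw' : ‖w‖ = R := by simpa using hw
      have hw0 : w ≠ 0 := by rintro rfl; simp at hw'; linarith
      apply hfd w hw0
      · intro h
        rw [Complex.sin_eq_zero_iff] at h
        obtain ⟨n, hn⟩ := h
        have : w = n / z := by
          rw [eq_div_iff hzc]; apply mul_left_cancel₀ hpi; linear_combination hn
        have h3 := szc_dist z R δ hR h2 w hw' n
        rw [this] at h3; simp at h3; linarith
      · intro h
        rw [Complex.cos_eq_zero_iff] at h
        obtain ⟨n, hn⟩ := h
        have : w = (2 * n + 1 : ℤ) / (2 : ℝ) := by
          apply mul_left_cancel₀ hpi; push_cast; linear_combination hn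
        have h3 := szc_dist 2 R δ hR h1 w hw' (2 * n + 1)
        rw [this] at h3; simp at h3; linarith
    have hPj : ∀ j ∈ Finset.range (k + 1), CircleIntegrable
        (fun w : ℂ => PowerSeries.coeff j Q * (w - 0) ^ ((j : ℤ) - (k + 1))) 0 R := by
      intro j _
      apply CircleIntegrable.const_fun_smul (a := PowerSeries.coeff j Q)
      rw [circleIntegrable_sub_zpow_iff]
      right; right
      rw [mem_sphere_zero_iff_norm, norm_zero]
      exact (abs_pos.2 hR.ne').ne
    have hPi : CircleIntegrable P 0 R := by
      exact CircleIntegrable.fun_sum _ hPj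
    have hPint : (∮ w in C(0, R), P w) = 2 * π * I * PowerSeries.coeff k Q := by
      rw [hP, circleIntegral.integral_fun_sum hPj, Finset.sum_range_succ, Finset.sum_eq_zero]
      · rw [circleIntegral.integral_const_mul]
        have : ((k : ℤ) - (k + 1)) = -1 := by ring
        simp only [this, zpow_neg_one]
        rw [circleIntegral.integral_sub_inv_of_mem_ball (by simpa using hR)]
        ring
      · intro j hj
        have := Finset.mem_range.1 hj
        rw [circleIntegral.integral_const_mul, circleIntegral.integral_sub_zpow_of_ne (by omega), mul_zero]
    rw [circleIntegral.integral_sub hci hPi, hPint] at key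
    rw [Finset.sum_disjSum] at key
    have her : ∑ x ∈ (Finset.Icc (-(L : ℤ)) L).erase 0, r (Sum.inr x) =
        ∑ x ∈ Finset.Icc (-(L : ℤ)) L, r (Sum.inr x) := by
      apply Finset.sum_erase
      simp [r]
    rw [her] at key
    simp only [r, Sum.elim_inl, Sum.elim_inr] at key
    linear_combination key
  · rintro (n | n) hi
    · have hi' : n ∈ Finset.Icc (-(M : ℤ)) M := by simpa [s] using hi
      exact hball z n hz h2 hi'
    · have hi' : n ∈ Finset.Icc (-(L : ℤ)) L := by
        simp only [s, Finset.inr_mem_disjSum] at hi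
        exact Finset.mem_of_mem_erase hi
      have := hball 2 n two_ne_zero h1 (by simpa using hi')
      simpa [a] using this
  · have hcross : ∀ (n m : ℤ), m ≠ 0 → (n : ℂ) / z ≠ (m : ℂ) / 2 := by
      intro n m hm h
      rw [div_eq_div_iff hzc two_ne_zero] at h
      apply hirr' (n * 2) m hm
      push_cast
      linear_combination -h
    rintro (n | n) hn (m | m) hm h
    · have h' : (n : ℂ) / z = (m : ℂ) / z := h
      rw [div_left_inj' hzc] at h'
      have : n = m := by exact_mod_cast h'
      rw [this]
    · exact absurd h (hcross n m (by rintro rfl; simp [s] at hm))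
    · exact absurd h.symm (hcross m n (by rintro rfl; simp [s] at hn))
    · have h' : (n : ℂ) / 2 = (m : ℂ) / 2 := h
      rw [div_left_inj' two_ne_zero] at h'
      have : n = m := by exact_mod_cast h'
      rw [this]
  · intro w hw hne
    have hw' : ‖w‖ ≤ R := by simpa using hw
    have hw0 : w ≠ 0 := by
      have := hne _ hs0
      simpa [a] using this
    apply DifferentiableAt.sub _ (hPd w hw0)
    apply hfd w hw0
    · intro h
      rw [Complex.sin_eq_zero_iff] at h
      obtain ⟨n, hn⟩ := h
      have : w = n / z := by
        rw [eq_div_iff hzc]; apply mul_left_cancel₀ hpi; linear_combination hn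
      apply hne (Sum.inl n) _ this
      rw [Finset.inl_mem_disjSum]
      apply hmem
      rw [this, hnorm, div_le_iff₀ hzp] at hw'
      exact hw'
    · intro h
      rw [Complex.cos_eq_zero_iff] at h
      obtain ⟨n, hn⟩ := h
      have : w = (2 * n + 1 : ℤ) / (2 : ℝ) := by
        apply mul_left_cancel₀ hpi; push_cast; linear_combination hn
      apply hne (Sum.inr (2 * n + 1)) _ (by simpa [a] using this)
      rw [Finset.inr_mem_disjSum, Finset.mem_erase]
      refine ⟨by omega, ?_⟩
      apply hmem
      rw [this, hnorm, div_le_iff₀ (by norm_num), abs_of_pos (by norm_num : (0:ℝ) < 2)] at hw'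
      exact hw'
  · intro i hi
    by_cases hi0 : a i = 0
    · have hi1 := hnz i hi hi0
      subst hi1
      have hr0 : r (Sum.inl 0) = 0 := by simp [r, hk.ne']
      rw [hr0, hi0]
      have hO := szcT_bigO Φ hΦa (k + 1)
      rw [hΦT] at hO
      rw [Asymptotics.isBigO_iff] at hO
      obtain ⟨c, hc⟩ := hO
      rw [tendsto_zero_iff_norm_tendsto_zero]
      have hlim : Filter.Tendsto (fun w : ℂ => c * ‖w‖) (nhdsWithin 0 {0}ᶜ) (nhds 0) := by
        have : Continuous (fun w : ℂ => c * ‖w‖) := by fun_prop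
        have := this.tendsto 0
        simp only [norm_zero, mul_zero] at this
        exact this.mono_left nhdsWithin_le_nhds
      refine squeeze_zero' (Filter.Eventually.of_forall fun _ => norm_nonneg _) ?_ hlim
      filter_upwards [nhdsWithin_le_nhds hc, self_mem_nhdsWithin] with w hw hw0
      have hw0 : w ≠ 0 := hw0
      have e : (w - 0) * (f w - P w) =
          (Φ w - ∑ j ∈ Finset.range (k + 1), PowerSeries.coeff j Q * w ^ j) / w ^ k := by
        have e1 : w * P w = (∑ j ∈ Finset.range (k + 1), PowerSeries.coeff j Q * w ^ j) / w ^ k := by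
          rw [hP, Finset.mul_sum, Finset.sum_div]
          apply Finset.sum_congr rfl
          intro j _
          rw [sub_zero, zpow_sub₀ hw0, zpow_natCast, zpow_add_one₀ hw0, zpow_natCast]
          field_simp
        rw [sub_zero, mul_sub, e1, sub_div, hΦ w hw0]
        congr 1
        rw [hf]
        simp only
        rw [div_div]; ring
      rw [e, norm_div, norm_pow, div_le_iff₀ (by positivity)]
      refine hw.trans (le_of_eq ?_)
      rw [Real.norm_of_nonneg (by positivity)]
      ring
    · -- simple poles
      have hPl : Filter.Tendsto (fun w => (w - a i) * P w) (nhdsWithin (a i) {a i}ᶜ) (nhds 0) := by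
        have : ContinuousAt (fun w => (w - a i) * P w) (a i) := by
          apply ContinuousAt.mul (by fun_prop)
          exact (hPd _ hi0).continuousAt
        have := this.tendsto
        simp only [sub_self, zero_mul] at this
        exact this.mono_left nhdsWithin_le_nhds
      suffices hfl : Filter.Tendsto (fun w => (w - a i) * f w) (nhdsWithin (a i) {a i}ᶜ) (nhds (r i)) by
        have := hfl.sub hPl
        rw [sub_zero] at this
        refine this.congr ?_
        intro w; ring
      rcases i with n | n
      · have han : a (Sum.inl n) = n / z := rfl
        have hn0 : (n : ℂ) / z ≠ 0 := hi0
        have hn1 : n ≠ 0 := by rintro rfl; simp at hn0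
        rw [han]
        have harg : (π * z * (n / z) : ℂ) = n * π := by field_simp
        have hcosn : Complex.cos (n * π) ≠ 0 := by
          intro h
          have h3 := Complex.sin_sq_add_cos_sq (n * π)
          rw [Complex.sin_int_mul_pi, h] at h3
          norm_num at h3
        have hcosz : Complex.cos (π * (n / z)) ≠ 0 := by
          intro h
          rw [Complex.cos_eq_zero_iff] at h
          obtain ⟨m, hm⟩ := h
          have h3 : (n : ℂ) / z = (2 * m + 1) / 2 := by
            apply mul_left_cancel₀ hpi; linear_combination hm
          rw [div_eq_div_iff hzc two_ne_zero] at h3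
          apply hirr' (n * 2) (2 * m + 1) (by omega)
          push_cast
          linear_combination -h3
        have hd : HasDerivAt (fun w : ℂ => Complex.sin (π * z * w))
            (Complex.cos (π * z * (n / z)) * (π * z * 1)) (n / z) :=
          ((hasDerivAt_id ((n : ℂ) / z)).const_mul (π * z : ℂ)).csin
        rw [harg] at hd
        have hl1 := szc_inv_lim _ _ _ hd (by rw [harg, Complex.sin_int_mul_pi]) (by
          simp [hcosn, hpi, hzc])
        have hl2 : Filter.Tendsto (fun w : ℂ => (π * z) / (Complex.cos (π * w) * w ^ k))
            (nhdsWithin ((n : ℂ) / z) {(n : ℂ) / z}ᶜ)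
            (nhds ((π * z) / (Complex.cos (π * (n / z)) * (n / z) ^ k))) := by
          have : ContinuousAt (fun w : ℂ => (π * z) / (Complex.cos (π * w) * w ^ k)) (n / z) := by
            apply ContinuousAt.div (by fun_prop) (by fun_prop)
            exact mul_ne_zero hcosz (pow_ne_zero _ hn0)
          exact this.tendsto.mono_left nhdsWithin_le_nhds
        have hl := hl1.mul hl2
        have hr : r (Sum.inl n) = (Complex.cos (n * π) * (π * z * 1))⁻¹ *
            ((π * z) / (Complex.cos (π * (n / z)) * (n / z) ^ k)) := by
          simp only [r, Sum.elim_inl]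
          rw [mul_comm (π : ℂ) (n : ℂ)]
          have := pow_ne_zero k hn0
          generalize ((n : ℂ) / z) ^ k = Y at *
          field_simp
        rw [hr]
        refine hl.congr ?_
        intro w
        rw [hf]
        simp only
        rw [div_mul_div_comm, mul_div_assoc', mul_assoc (Complex.sin _)]
      · have han : a (Sum.inr n) = n / 2 := rfl
        have hn0 : (n : ℂ) / 2 ≠ 0 := hi0
        have hn1 : n ≠ 0 := by rintro rfl; simp at hn0
        rw [han]
        have hsinz : Complex.sin (π * z * (n / 2)) ≠ 0 := by
          intro h
          rw [Complex.sin_eq_zero_iff] at h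
          obtain ⟨m, hm⟩ := h
          apply hirr' (m * 2) n hn1
          push_cast
          apply mul_left_cancel₀ hpi
          linear_combination 2 * hm
        have hsc : Complex.sin (π * (n / 2)) * Complex.cos (π * (n / 2)) = 0 := by
          have h3 := Complex.sin_two_mul (π * (n / 2))
          rw [show (2 * (π * (n / 2)) : ℂ) = n * π by ring, Complex.sin_int_mul_pi] at h3
          linear_combination -h3 / 2
        have hsq := Complex.sin_sq_add_cos_sq (π * (n / 2))
        by_cases hc : Complex.cos (π * (n / 2)) = 0
        · have hsn : Complex.sin (π * (n / 2)) ≠ 0 := by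
            intro h; rw [h, hc] at hsq; norm_num at hsq
          have hd : HasDerivAt (fun w : ℂ => Complex.cos (π * w))
              (-Complex.sin (π * (n / 2)) * (π * 1)) (n / 2) :=
            ((hasDerivAt_id ((n : ℂ) / 2)).const_mul (π : ℂ)).ccos
          have hl1 := szc_inv_lim _ _ _ hd hc (by simp [hsn, hpi])
          have hl2 : Filter.Tendsto (fun w : ℂ => (π * z) / (Complex.sin (π * z * w) * w ^ k))
              (nhdsWithin ((n : ℂ) / 2) {(n : ℂ) / 2}ᶜ)
              (nhds ((π * z) / (Complex.sin (π * z * (n / 2)) * (n / 2) ^ k))) := by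
            have : ContinuousAt (fun w : ℂ => (π * z) / (Complex.sin (π * z * w) * w ^ k)) (n / 2) := by
              apply ContinuousAt.div (by fun_prop) (by fun_prop)
              exact mul_ne_zero hsinz (pow_ne_zero _ hn0)
            exact this.tendsto.mono_left nhdsWithin_le_nhds
          have hl := hl1.mul hl2
          have hr : r (Sum.inr n) = (-Complex.sin (π * (n / 2)) * (π * 1))⁻¹ *
              ((π * z) / (Complex.sin (π * z * (n / 2)) * (n / 2) ^ k)) := by
            simp only [r, Sum.elim_inr]
            have := pow_ne_zero k hn0
            generalize ((n : ℂ) / 2) ^ k = Y at *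
            rw [hc] at hsq
            generalize Complex.sin (π * (n / 2)) = s1 at *
            generalize Complex.sin (π * z * (n / 2)) = s2 at *
            have hs1 : s1⁻¹ = s1 := by
              field_simp
              linear_combination -hsq
            rw [mul_inv, inv_neg, hs1]
            field_simp
          rw [hr]
          refine hl.congr ?_
          intro w
          rw [hf]
          simp only
          rw [div_mul_div_comm, mul_div_assoc']
          congr 1
          ring
        · have hsn : Complex.sin (π * (n / 2)) = 0 := by
            rcases mul_eq_zero.1 hsc with h | h
            · exact h
            · exact absurd h hc
          have hr : r (Sum.inr n) = 0 := by
            simp only [r, Sum.elim_inr]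
            rw [hsn]; simp
          rw [hr]
          have : ContinuousAt (fun w => (w - (n : ℂ) / 2) * f w) (n / 2) := by
            apply ContinuousAt.mul (by fun_prop)
            exact (hfd _ hn0 hsinz hc).continuousAt
          have := this.tendsto
          simp only [sub_self, zero_mul] at this
          exact this.mono_left nhdsWithin_le_nhds

theorem secant_zeta_coefficient_identity (k : ℕ) (hk : 0 < k) (hkeven : Even k)
    (z : ℝ) (hirr : Irrational z) (halg : IsAlgebraic ℚ z)
    (hs1 : Summable (fun n : ℕ =>
      |chiFour (n + 1) * (1 / Real.sin (π * (n + 1) * z / 2))| / ((n : ℝ) + 1) ^ k))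
    (hs2 : Summable (fun n : ℕ =>
      |1 / Real.cos (π * (n + 1) * (1 + 1 / z))| / ((n : ℝ) + 1) ^ k)) :
    ((π : ℂ) * Complex.I) ^ k / (k.factorial : ℂ) *
        ∑ m ∈ Finset.range (k + 1),
          ((2 : ℂ) ^ ((m : ℤ) - 1) - 1) * (bernoulli m : ℂ) * (eulerNumber (k - m) : ℂ) *
            (k.choose m : ℂ) * ((z : ℂ) ^ ((m : ℤ) - 1)) =
      -(2 : ℂ) ^ k *
          ((∑' n : ℕ, chiFour (n + 1) * (1 / Real.sin (π * (n + 1) * z / 2)) /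
            ((n : ℝ) + 1) ^ k : ℝ) : ℂ) +
        ((z : ℂ) ^ ((k : ℤ) - 1)) *
          ((∑' n : ℕ, 1 / Real.cos (π * (n + 1) * (1 + 1 / z)) / ((n : ℝ) + 1) ^ k : ℝ) : ℂ) := by
  have hz : z ≠ 0 := hirr.ne_zero
  have hzp : 0 < |z| := abs_pos.2 hz
  have hzc : (z : ℂ) ≠ 0 := by exact_mod_cast hz
  have hpi : (π : ℂ) ≠ 0 := by exact_mod_cast Real.pi_ne_zero
  have hk2 : k - 1 ≠ 0 := by
    obtain ⟨m, hm⟩ := hkeven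
    omega
  obtain ⟨δ, hδ, hrad⟩ := szc_radius z hz
  choose R hRN hR0 hR1 hR2 using hrad
  obtain ⟨C, hC⟩ := szc_bound z hz δ hδ k
  have hRtop : Filter.Tendsto R Filter.atTop Filter.atTop :=
    Filter.tendsto_atTop_mono hRN tendsto_natCast_atTop_atTop
  set J : ℕ → ℂ := fun N => ∮ w in C(0, R N),
    (π * z : ℂ) / (Complex.sin (π * z * w) * Complex.cos (π * w) * w ^ k) with hJ
  have hJ0 : Filter.Tendsto J Filter.atTop (nhds 0) := by
    have h1 : Filter.Tendsto (fun N => 2 * π * (C / R N ^ (k - 1))) Filter.atTop (nhds 0) := by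
      have := (((Filter.tendsto_pow_atTop hk2).comp hRtop).const_div_atTop C).const_mul (2 * π)
      simpa using this
    refine squeeze_zero_norm ?_ h1
    intro N
    have := circleIntegral.norm_integral_le_of_norm_le_const (hR0 N).le
      (hC (R N) (hR0 N) (hR1 N) (hR2 N))
    refine this.trans (le_of_eq ?_)
    have h3 : R N ^ k = R N ^ (k - 1) * R N := by
      rw [← pow_succ]; congr 1; omega
    have h4 := (hR0 N).ne'
    rw [h3]
    field_simp
  set A : ℕ → ℝ := fun n => chiFour (n + 1) * (1 / Real.sin (π * (n + 1) * z / 2)) /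
            ((n : ℝ) + 1) ^ k with hA
  set B : ℕ → ℝ := fun n => 1 / Real.cos (π * (n + 1) * (1 + 1 / z)) / ((n : ℝ) + 1) ^ k with hB
  have hAs : Summable A := by
    apply Summable.of_norm
    refine hs1.congr ?_
    intro n
    rw [hA, Real.norm_eq_abs, abs_div, abs_of_pos (by positivity : (0:ℝ) < ((n : ℝ) + 1) ^ k)]
  have hBs : Summable B := by
    apply Summable.of_norm
    refine hs2.congr ?_
    intro n
    simp only [hB]
    rw [Real.norm_eq_abs, abs_div (1 / Real.cos _), abs_of_pos (by positivity : (0:ℝ) < ((n : ℝ) + 1) ^ k)]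
  set r1 : ℤ → ℂ := fun n =>
    (1 / (Complex.cos (π * n) * Complex.cos (π * (n / z)) * (n / z) ^ k) : ℂ) with hr1
  set r2 : ℤ → ℂ := fun n =>
    (-z * Complex.sin (π * (n / 2)) / (Complex.sin (π * z * (n / 2)) * (n / 2) ^ k) : ℂ) with hr2
  have e1 : ∀ n : ℕ, r1 ((n : ℤ) + 1) = (z : ℂ) ^ k * ((B n : ℝ) : ℂ) := by
    intro n
    simp only [hr1, hB]
    have h1 : Real.cos (π * (n + 1) * (1 + 1 / z)) =
        Real.cos (π * (n + 1)) * Real.cos (π * ((n + 1) / z)) := by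
      have h2 : Real.sin (π * (n + 1)) = 0 := by
        have := Real.sin_nat_mul_pi (n + 1)
        push_cast at this
        rwa [mul_comm]
      rw [show π * (n + 1) * (1 + 1 / z) = π * (n + 1) + π * ((n + 1) / z) by field_simp,
        Real.cos_add, h2]
      ring
    rw [h1]
    push_cast
    have h3 : ((n : ℂ) + 1) ≠ 0 := by exact_mod_cast Nat.succ_ne_zero n
    rw [div_pow]
    generalize Complex.cos (π * ((n + 1) / z)) = Y
    generalize Complex.cos (π * (n + 1)) = W
    rw [div_div, mul_div_assoc', mul_div_assoc', one_div_div, mul_one]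
  have e2 : ∀ n : ℕ, r2 ((n : ℤ) + 1) = (-(z : ℂ) * 2 ^ k) * ((A n : ℝ) : ℂ) := by
    intro n
    simp only [hr2, hA]
    rw [szc_chi]
    push_cast
    rw [show (π * z * ((n + 1) / 2) : ℂ) = π * (n + 1) * z / 2 by ring,
      show (π * ((n + 1) / 2) : ℂ) = π * (n + 1) / 2 by ring, div_pow]
    generalize Complex.sin (π * (n + 1) / 2) = Y
    generalize Complex.sin (π * (n + 1) * z / 2) = W
    rw [mul_div_assoc', div_div_eq_mul_div, mul_one_div, div_div]
    ring
  have hJeq : ∀ N, J N = 2 * π * I * (PowerSeries.coeff k (PowerSeries.rescale (π * I) szcE *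
        PowerSeries.rescale (π * I * z) szcC) +
      2 * ((z : ℂ) ^ k * ((∑ n ∈ Finset.range ⌊R N * |z|⌋₊, B n : ℝ) : ℂ)) +
      2 * ((-(z : ℂ) * 2 ^ k) * ((∑ n ∈ Finset.range ⌊R N * 2⌋₊, A n : ℝ) : ℂ))) := by
    intro N
    have h := szc_circle z hirr k hk (R N) (hR0 N) δ hδ (hR1 N) (hR2 N)
    have s1 := szc_sum_sym r1 (by simp [hr1, hk.ne']) (by
      intro n
      simp only [hr1]
      push_cast
      rw [neg_div, mul_neg, mul_neg, Complex.cos_neg, Complex.cos_neg, hkeven.neg_pow]) ⌊R N * |z|⌋₊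
    have s2 := szc_sum_sym r2 (by simp [hr2]) (by
      intro n
      simp only [hr2]
      push_cast
      rw [neg_div, mul_neg, mul_neg, Complex.sin_neg, Complex.sin_neg, hkeven.neg_pow, mul_neg, neg_mul (Complex.sin _),
        neg_div_neg_eq]) ⌊R N * 2⌋₊
    simp only [e1] at s1
    simp only [e2] at s2
    rw [← Finset.mul_sum, ← Complex.ofReal_sum] at s1 s2
    rw [← s1, ← s2]
    exact h
  have hM : Filter.Tendsto (fun N => ⌊R N * |z|⌋₊) Filter.atTop Filter.atTop :=
    tendsto_nat_floor_atTop.comp (hRtop.atTop_mul_const hzp)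
  have hL : Filter.Tendsto (fun N => ⌊R N * 2⌋₊) Filter.atTop Filter.atTop :=
    tendsto_nat_floor_atTop.comp (hRtop.atTop_mul_const two_pos)
  have tB := (Complex.continuous_ofReal.tendsto _).comp (hBs.hasSum.tendsto_sum_nat.comp hM)
  have tA := (Complex.continuous_ofReal.tendsto _).comp (hAs.hasSum.tendsto_sum_nat.comp hL)
  have tJ := ((((tB.const_mul ((z : ℂ) ^ k)).const_mul 2).const_add
    (PowerSeries.coeff k (PowerSeries.rescale (π * I : ℂ) szcE *
        PowerSeries.rescale (π * I * z : ℂ) szcC))).add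
    ((tA.const_mul (-(z : ℂ) * 2 ^ k)).const_mul 2)).const_mul (2 * π * I : ℂ)
  have hfin := tendsto_nhds_unique (tJ.congr (fun N => (hJeq N).symm)) hJ0
  rw [szc_coeff z hzc k] at hfin
  have h2pi : (2 * π * I : ℂ) ≠ 0 := by simp [hpi]
  have hfin' := (mul_eq_zero.1 hfin).resolve_left h2pi
  rw [zpow_sub_one₀ hzc, zpow_natCast]
  generalize ((π : ℂ) * Complex.I) ^ k / (k.factorial : ℂ) *
        ∑ m ∈ Finset.range (k + 1),
          ((2 : ℂ) ^ ((m : ℤ) - 1) - 1) * (bernoulli m : ℂ) * (eulerNumber (k - m) : ℂ) *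
            (k.choose m : ℂ) * ((z : ℂ) ^ ((m : ℤ) - 1)) = X at *
  have hzi : (z : ℂ) * (z : ℂ)⁻¹ = 1 := mul_inv_cancel₀ hzc
  apply mul_left_cancel₀ hzc
  linear_combination (-1 / 2) * hfin' - (z : ℂ) ^ k * ((∑' n, B n : ℝ) : ℂ) * hzi
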